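/- (Theorem 4.3, first Riccati equation.) For every integer n ≥ 0, every index 1 ≤ j ≤ N and every t ∈ U: δR_{n,j}(t) = 4·r_{n,j}(t) − (2t_j − Σ_{k=1}^N R_{n,k}(t))·R_{n,j}(t) − 2γ_j, where δ = Σ_{k=1}^N ∂/∂t_k. -/

import Mathlib

open MeasureTheory Polynomial

noncomputable def pd {N : ℕ} (j : Fin N) (f : (Fin N → ℝ) → ℝ) (x : Fin N → ℝ) : ℝ :=
  deriv (fun s => f (Function.update x j s)) (x j)

/-- A function on the line all of whose two-sided exponential moments are finite. -/
def HasExpMoments (v : ℝ → ℝ) : Prop :=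
  ∀ c : ℝ, Integrable fun z => Real.exp (c * |z|) * v z

namespace HasExpMoments

variable {v : ℝ → ℝ}

theorem aestronglyMeasurable (hv : HasExpMoments v) : AEStronglyMeasurable v := by
  simpa using (hv 0).aestronglyMeasurable

theorem integrable_of_bound (hv : HasExpMoments v) {g : ℝ → ℝ} (hg : Continuous g) (K c : ℝ)
    (hb : ∀ z, |g z| ≤ K * Real.exp (c * |z|)) : Integrable fun z => g z * v z := by
  refine ((hv c).const_mul K).mono (hg.aestronglyMeasurable.mul hv.aestronglyMeasurable) ?_
  filter_upwards with z
  simp only [norm_mul, Real.norm_eq_abs, Real.abs_exp]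
  calc |g z| * |v z| ≤ (K * Real.exp (c * |z|)) * |v z| := by gcongr; exact hb z
    _ ≤ |K| * Real.exp (c * |z|) * |v z| := by gcongr; exact le_abs_self K
    _ = _ := by ring

theorem integrable_pow_mul (hv : HasExpMoments v) (m : ℕ) :
    Integrable fun z => z ^ m * v z := by
  refine hv.integrable_of_bound (continuous_pow m) m.factorial 1 fun z => ?_
  have := Real.pow_div_factorial_le_exp |z| (abs_nonneg z) m
  rw [div_le_iff₀ (by positivity)] at this
  rw [abs_pow, one_mul]; linarith

theorem integrable_eval_mul (hv : HasExpMoments v) (p : ℝ[X]) :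
    Integrable fun z => p.eval z * v z := by
  simp only [eval_eq_sum_range, Finset.sum_mul, mul_assoc]
  exact integrable_finsetSum _ fun i _ => (hv.integrable_pow_mul i).const_mul _

theorem hasDerivAt_integral_pow (hv : HasExpMoments v) (m : ℕ) :
    HasDerivAt (fun s : ℝ => ∫ z, z ^ m * (Real.exp (-2 * s * z) * v z))
      (∫ z, z ^ m * (-2 * z) * v z) 0 := by
  have key := hasDerivAt_integral_of_dominated_loc_of_deriv_le (μ := volume) (𝕜 := ℝ)
    (F := fun s z => z ^ m * (Real.exp (-2 * s * z) * v z)) (x₀ := 0)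
    (s := Metric.ball 0 1)
    (F' := fun s z => z ^ m * (Real.exp (-2 * s * z) * (-2 * z) * v z))
    (bound := fun z => 2 * |z ^ (m + 1) * (Real.exp (2 * |z|) * v z)|)
    (Metric.ball_mem_nhds _ one_pos) ?_ ?_ ?_ ?_ ?_ ?_
  · simpa [mul_assoc] using key.2
  · filter_upwards with s
    exact (by fun_prop : Continuous fun z : ℝ => z ^ m).aestronglyMeasurable.mul
      ((by fun_prop : Continuous fun z : ℝ => Real.exp (-2 * s * z)).aestronglyMeasurable.mul
        hv.aestronglyMeasurable)
  · simpa using hv.integrable_pow_mul m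
  · exact (by fun_prop : Continuous fun z : ℝ => z ^ m).aestronglyMeasurable.mul
      ((by fun_prop : Continuous fun z : ℝ =>
        Real.exp (-2 * 0 * z) * (-2 * z)).aestronglyMeasurable.mul hv.aestronglyMeasurable)
  · filter_upwards with z s hs
    have hs' : |s| ≤ 1 := by simpa using (mem_ball_zero_iff.1 hs).le
    have h1 : -2 * s * z ≤ 2 * |z| := by
      calc -2 * s * z ≤ |-2 * s * z| := le_abs_self _
        _ = 2 * |s| * |z| := by simp [abs_mul]
        _ ≤ 2 * 1 * |z| := by gcongr
        _ = _ := by ring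
    have h2 := Real.exp_le_exp.2 h1
    simp only [norm_mul, norm_pow, Real.norm_eq_abs, Real.abs_exp, abs_mul, abs_pow, abs_neg,
      abs_two]
    calc _ = 2 * |z| ^ (m + 1) * |v z| * Real.exp (-2 * s * z) := by ring
      _ ≤ 2 * |z| ^ (m + 1) * |v z| * Real.exp (2 * |z|) := by gcongr
      _ = _ := by ring
  · have h2 : HasExpMoments fun z => Real.exp (2 * |z|) * v z := fun c => by
      refine (hv (c + 2)).congr (Filter.Eventually.of_forall fun z => ?_)
      simp only [← mul_assoc, ← Real.exp_add]; ring_nf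
    exact (h2.integrable_pow_mul (m + 1)).abs.const_mul 2
  · filter_upwards with z s _
    have h1 : HasDerivAt (fun s : ℝ => -2 * s * z) (-2 * z) s := by
      simpa using ((hasDerivAt_id s).const_mul (-2)).mul_const z
    simpa [mul_assoc] using ((h1.exp.mul_const (v z)).const_mul (z ^ m))

theorem integrable_pow_mul_exp (hv : HasExpMoments v) (m : ℕ) (s : ℝ) :
    Integrable fun z => z ^ m * (Real.exp (-2 * s * z) * v z) := by
  have h2 : HasExpMoments fun z => Real.exp (-2 * s * z) * v z := fun c => by
    have := hv.integrable_of_bound (g := fun z => Real.exp (c * |z|) * Real.exp (-2 * s * z))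
      (by fun_prop) 1 (c + 2 * |s|) fun z => by
        rw [← Real.exp_add, Real.abs_exp, one_mul, Real.exp_le_exp]
        have := neg_abs_le (s * z)
        rw [abs_mul] at this
        linarith
    simpa [mul_assoc] using this
  exact h2.integrable_pow_mul m

/-- Differentiation at the origin of the integral of a polynomial family of bounded degree
against the weight `exp (-2 s z) v z`. -/
theorem hasDerivAt_integral_eval (hv : HasExpMoments v) {A : ℝ → ℝ[X]} {D : ℝ[X]} {d : ℕ}
    (hdeg : ∀ᶠ s in nhds 0, (A s).natDegree ≤ d)
    (hA : ∀ k, HasDerivAt (fun s => (A s).coeff k) (D.coeff k) 0) :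
    HasDerivAt (fun s : ℝ => ∫ z, (A s).eval z * (Real.exp (-2 * s * z) * v z))
      (∫ z, (D - 2 * X * A 0).eval z * v z) 0 := by
  have hD : D.natDegree < d + 1 := by
    rw [Nat.lt_succ_iff, natDegree_le_iff_coeff_eq_zero]
    intro k hk
    refine (hA k).unique ((hasDerivAt_const (0 : ℝ) (0 : ℝ)).congr_of_eventuallyEq ?_)
    filter_upwards [hdeg] with s hs
    exact coeff_eq_zero_of_natDegree_lt (by omega)
  have hA0 : (A 0).natDegree < d + 1 := Nat.lt_succ_iff.2 hdeg.self_of_nhds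
  have hsum := HasDerivAt.fun_sum (u := Finset.range (d + 1)) fun k _ =>
    (hA k).mul (hv.hasDerivAt_integral_pow k)
  refine (hsum.congr_of_eventuallyEq ?_).congr_deriv ?_
  · filter_upwards [hdeg] with s hs
    simp only [eval_eq_sum_range' (Nat.lt_succ_iff.2 hs), Finset.sum_mul, mul_assoc]
    rw [integral_finsetSum]
    · simp only [integral_const_mul, Pi.mul_apply]
    · intro i _
      have := (hv.integrable_pow_mul_exp i s).const_mul ((A s).coeff i)
      simpa only [mul_assoc] using this
  · rw [Finset.sum_add_distrib]
    have e1 : ∫ z, D.eval z * v z = ∑ k ∈ Finset.range (d + 1), D.coeff k * ∫ z, z ^ k * v z := by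
      simp only [eval_eq_sum_range' hD, Finset.sum_mul, mul_assoc]
      rw [integral_finsetSum _ fun i _ => (hv.integrable_pow_mul i).const_mul _]
      simp only [integral_const_mul]
    have e2 : ∫ z, (2 * X * A 0).eval z * v z =
        - ∑ k ∈ Finset.range (d + 1), (A 0).coeff k * ∫ z, z ^ k * (-2 * z) * v z := by
      rw [← Finset.sum_neg_distrib]
      have : ∀ z, (2 * X * A 0).eval z * v z =
          ∑ k ∈ Finset.range (d + 1), (-(A 0).coeff k) * (z ^ k * (-2 * z) * v z) := fun z => by
        simp only [eval_mul, eval_X, eval_ofNat, eval_eq_sum_range' hA0, Finset.sum_mul,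
          Finset.mul_sum]
        exact Finset.sum_congr rfl fun k _ => by ring
      simp only [this]
      rw [integral_finsetSum _ fun i _ => ?_]
      · exact Finset.sum_congr rfl fun k _ => by rw [integral_const_mul, neg_mul]
      · refine (((hv.integrable_pow_mul (i + 1)).const_mul (-2)).congr
          (Filter.Eventually.of_forall fun z => ?_)).const_mul _
        ring
    simp only [eval_sub, sub_mul]
    rw [integral_sub (hv.integrable_eval_mul D) (hv.integrable_eval_mul (2 * X * A 0)), e1, e2]
    simp

/-- Integration of polynomials against `v` as a linear functional. -/
noncomputable def functional (hv : HasExpMoments v) : ℝ[X] →ₗ[ℝ] ℝ where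
  toFun p := ∫ z, p.eval z * v z
  map_add' p q := by
    simp only [eval_add, add_mul]
    exact integral_add (hv.integrable_eval_mul p) (hv.integrable_eval_mul q)
  map_smul' c p := by
    simp only [eval_smul, smul_eq_mul, mul_assoc, integral_const_mul, RingHom.id_apply]

theorem functional_apply (hv : HasExpMoments v) (p : ℝ[X]) :
    hv.functional p = ∫ z, p.eval z * v z := rfl

end HasExpMoments

/-- A differentiable family of monic polynomials of degree `n` has a coefficientwise derivative
of degree less than `n`. -/
theorem exists_hasDerivAt_coeff {A : ℝ → ℝ[X]} {n : ℕ} (hmonic : ∀ᶠ s in nhds 0, (A s).Monic)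
    (hdeg : ∀ᶠ s in nhds 0, (A s).natDegree = n)
    (hA : ∀ k, DifferentiableAt ℝ (fun s => (A s).coeff k) 0) :
    ∃ D : ℝ[X], D.degree < n ∧ ∀ k, HasDerivAt (fun s => (A s).coeff k) (D.coeff k) 0 := by
  refine ⟨∑ i ∈ Finset.range n, monomial i (deriv (fun s => (A s).coeff i) 0), ?_, fun k => ?_⟩
  · refine lt_of_le_of_lt (degree_sum_le _ _) ((Finset.sup_lt_iff (WithBot.bot_lt_coe n)).2 ?_)
    intro i hi
    exact (degree_monomial_le _ _).trans_lt (WithBot.coe_lt_coe.2 (Finset.mem_range.1 hi))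
  · simp only [finsetSum_coeff, coeff_monomial, Finset.sum_ite_eq', Finset.mem_range]
    split_ifs with hk
    · exact (hA k).hasDerivAt
    · refine (hasDerivAt_const (0 : ℝ) (if k = n then (1 : ℝ) else 0)).congr_of_eventuallyEq ?_
      filter_upwards [hmonic, hdeg] with s hs hs'
      split_ifs with hkn
      · rw [hkn, ← hs', hs.coeff_natDegree]
      · exact coeff_eq_zero_of_natDegree_lt (by omega)

theorem hasDerivAt_coeff_mul {A B : ℝ → ℝ[X]} {D E : ℝ[X]}
    (hA : ∀ k, HasDerivAt (fun s => (A s).coeff k) (D.coeff k) 0)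
    (hB : ∀ k, HasDerivAt (fun s => (B s).coeff k) (E.coeff k) 0) (k : ℕ) :
    HasDerivAt (fun s => (A s * B s).coeff k) ((D * B 0 + A 0 * E).coeff k) 0 := by
  simp only [coeff_add, coeff_mul]
  rw [← Finset.sum_add_distrib]
  exact HasDerivAt.fun_sum fun i _ => (hA i.1).mul (hB i.2)

/-- Coefficients of a Taylor shifted differentiable family are differentiable. -/
theorem differentiableAt_coeff_taylor {A : ℝ → ℝ[X]} {n : ℕ}
    (hdeg : ∀ᶠ s in nhds 0, (A s).natDegree = n)
    (hA : ∀ k, DifferentiableAt ℝ (fun s => (A s).coeff k) 0) (k : ℕ) :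
    DifferentiableAt ℝ (fun s => (taylor s (A s)).coeff k) 0 := by
  have h1 : DifferentiableAt ℝ (fun s : ℝ => ∑ i ∈ Finset.range (n + 1),
      (A s).coeff i * (s ^ (i - k) * (i.choose k : ℝ))) 0 :=
    DifferentiableAt.fun_sum fun i _ => (hA i).mul (by fun_prop)
  refine h1.congr_of_eventuallyEq ?_
  filter_upwards [hdeg] with s hs
  conv_lhs => rw [(A s).as_sum_range' (n + 1) (by omega)]
  simp only [map_sum, taylor_monomial, finsetSum_coeff, coeff_C_mul, coeff_X_add_C_pow]

section OrthogonalSequence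

variable {L : ℝ[X] →ₗ[ℝ] ℝ} {S : ℕ → ℝ[X]}

/-- An orthogonal sequence is orthogonal to all polynomials of smaller degree. -/
theorem apply_mul_eq_zero_of_degree_lt (hmonic : ∀ n, (S n).Monic)
    (hdeg : ∀ n, (S n).natDegree = n) {n : ℕ} {q : ℝ[X]} (hn : ∀ m < n, L (q * S m) = 0)
    {p : ℝ[X]} (hp : p.degree < n) : L (q * p) = 0 := by
  let T : Polynomial.Sequence ℝ :=
    ⟨S, fun i => by rw [degree_eq_natDegree (hmonic i).ne_zero, hdeg i]⟩
  have hspan := T.span_degreeLT (m := n) fun i _ => by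
    change IsUnit (S i).leadingCoeff
    rw [hmonic i]; exact isUnit_one
  have hle : Submodule.span ℝ (T '' Set.Iio n) ≤
      LinearMap.ker (L ∘ₗ LinearMap.mulLeft ℝ q) := by
    rw [Submodule.span_le]
    rintro _ ⟨m, hm, rfl⟩
    exact hn m hm
  rw [hspan] at hle
  exact hle (mem_degreeLT.2 hp)

theorem degree_sub_smul_lt (hmonic : ∀ n, (S n).Monic) (hdeg : ∀ n, (S n).natDegree = n)
    {p : ℝ[X]} (hp : p ≠ 0) :
    (p - C p.leadingCoeff * S p.natDegree).degree < p.natDegree := by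
  have hc : p.leadingCoeff ≠ 0 := leadingCoeff_ne_zero.2 hp
  have hS : (S p.natDegree).degree = p.degree := by
    rw [degree_eq_natDegree (hmonic _).ne_zero, hdeg, degree_eq_natDegree hp]
  have := degree_sub_lt_left (p := p) (q := C p.leadingCoeff * S p.natDegree)
    (by rw [degree_C_mul hc, hS]) hp (by simp [(hmonic _).leadingCoeff])
  rwa [degree_eq_natDegree hp] at this

variable (hmonic : ∀ n, (S n).Monic) (hdeg : ∀ n, (S n).natDegree = n)
  (horth : ∀ m n, m ≠ n → L (S m * S n) = 0) (hpos : ∀ n, L (S n * S n) ≠ 0)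
include hmonic hdeg horth

theorem orthogonal_of_degree_lt {n : ℕ} {p : ℝ[X]} (hp : p.degree < n) :
    L (S n * p) = 0 :=
  apply_mul_eq_zero_of_degree_lt hmonic hdeg (fun m hm => horth n m hm.ne') hp

theorem apply_X_mul_mul_of_le {n m : ℕ} (hm : m ≤ n) :
    L (X * S (n + 1) * S m) = if m = n then L (S (n + 1) * S (n + 1)) else 0 := by
  split_ifs with hmn
  · subst hmn
    have hX : (X * S m) ≠ 0 := mul_ne_zero X_ne_zero (hmonic m).ne_zero
    have hnat : (X * S m).natDegree = m + 1 := by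
      rw [natDegree_X_mul (hmonic m).ne_zero, hdeg]
    have h1 := degree_sub_smul_lt hmonic hdeg hX
    rw [hnat, (monic_X.mul (hmonic m)).leadingCoeff, C_1, one_mul] at h1
    have h2 := orthogonal_of_degree_lt hmonic hdeg horth h1
    rw [mul_sub, map_sub, sub_eq_zero] at h2
    rw [← h2]; congr 1; ring
  · have h1 : (X * S m).degree < ((n + 1 : ℕ) : WithBot ℕ) := by
      refine (natDegree_lt_iff_degree_lt (mul_ne_zero X_ne_zero (hmonic m).ne_zero)).1 ?_
      rw [natDegree_X_mul (hmonic m).ne_zero, hdeg]; omega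
    rw [← orthogonal_of_degree_lt hmonic hdeg horth h1]; congr 1; ring

include hpos

theorem eq_zero_of_apply_mul_eq_zero {n : ℕ} {p : ℝ[X]} (hp : p.degree < n)
    (h0 : ∀ m < n, L (p * S m) = 0) : p = 0 := by
  by_contra hne
  have hlt : p.natDegree < n := (natDegree_lt_iff_degree_lt hne).2 hp
  have h1 := orthogonal_of_degree_lt hmonic hdeg horth (degree_sub_smul_lt hmonic hdeg hne)
  have h2 := h0 _ hlt
  rw [mul_sub, map_sub, mul_comm _ p, h2, mul_left_comm, ← smul_eq_C_mul, map_smul, zero_sub,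
    neg_eq_zero, smul_eq_mul] at h1
  exact mul_ne_zero (leadingCoeff_ne_zero.2 hne) (hpos _) h1

theorem eq_C_mul_of_apply_mul_eq {n : ℕ} {D : ℝ[X]} (hD : D.degree < ((n + 1 : ℕ) : WithBot ℕ))
    (h0 : ∀ m < n + 1, L (D * S m) = L (2 * X * S (n + 1) * S m)) :
    D = C (2 * (L (S (n + 1) * S (n + 1)) / L (S n * S n))) * S n := by
  set c := 2 * (L (S (n + 1) * S (n + 1)) / L (S n * S n)) with hc
  have h2 : ∀ p : ℝ[X], L (2 * p) = 2 * L p := fun p => by rw [two_mul, map_add, two_mul]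
  refine sub_eq_zero.1 (eq_zero_of_apply_mul_eq_zero hmonic hdeg horth hpos (n := n + 1) ?_ ?_)
  · refine (degree_sub_le _ _).trans_lt (max_lt hD ?_)
    refine degree_le_natDegree.trans_lt (WithBot.coe_lt_coe.2 (Nat.lt_succ_iff.2 ?_))
    exact (natDegree_C_mul_le _ _).trans_eq (hdeg n)
  · intro m hm
    have hX := apply_X_mul_mul_of_le hmonic hdeg horth (Nat.lt_succ_iff.1 hm)
    rw [sub_mul, map_sub, h0 m hm, mul_assoc 2, mul_assoc 2, h2, hX, mul_assoc, ← smul_eq_C_mul,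
      map_smul, smul_eq_mul]
    split_ifs with hmn
    · subst hmn
      have := hpos m
      rw [hc]; field_simp; ring
    · rw [horth n m (Ne.symm hmn)]; simp

end OrthogonalSequence

/-- Evolution of monic orthogonal polynomials under the exponential deformation
`exp (-2 s z) v z` of a weight `v`. -/
theorem HasExpMoments.exists_hasDerivAt_orthogonal {v : ℝ → ℝ} (hv : HasExpMoments v)
    {Q : ℕ → ℝ → ℝ[X]} (hmonic : ∀ n, ∀ᶠ s in nhds 0, (Q n s).Monic)
    (hdeg : ∀ n, ∀ᶠ s in nhds 0, (Q n s).natDegree = n)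
    (hdiff : ∀ n k, DifferentiableAt ℝ (fun s => (Q n s).coeff k) 0)
    (horth : ∀ m n, m ≠ n → ∀ᶠ s in nhds 0,
      ∫ z, (Q m s * Q n s).eval z * (Real.exp (-2 * s * z) * v z) = 0)
    (hpos : ∀ n, hv.functional (Q n 0 * Q n 0) ≠ 0) :
    ∃ D : ℕ → ℝ[X], (∀ n k, HasDerivAt (fun s => (Q n s).coeff k) ((D n).coeff k) 0) ∧
      D 0 = 0 ∧ ∀ n, D (n + 1) = C (2 * (hv.functional (Q (n + 1) 0 * Q (n + 1) 0) /
        hv.functional (Q n 0 * Q n 0))) * Q n 0 := by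
  have horth0 : ∀ m n, m ≠ n → hv.functional (Q m 0 * Q n 0) = 0 := fun m n hmn => by
    simpa [HasExpMoments.functional_apply] using (horth m n hmn).self_of_nhds
  have hmonic0 n := (hmonic n).self_of_nhds
  have hdeg0 n := (hdeg n).self_of_nhds
  choose D hDdeg hD using fun n => exists_hasDerivAt_coeff (hmonic n) (hdeg n) (hdiff n)
  refine ⟨D, hD, by simpa [Nat.WithBot.lt_zero_iff] using hDdeg 0, fun n => ?_⟩
  refine eq_C_mul_of_apply_mul_eq hmonic0 hdeg0 horth0 hpos (hDdeg (n + 1)) ?_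
  intro m hm
  have hder := hv.hasDerivAt_integral_eval (A := fun s => Q (n + 1) s * Q m s)
    (d := n + 1 + m) (by
      filter_upwards [hdeg (n + 1), hdeg m] with s h1 h2
      exact natDegree_mul_le.trans (by rw [h1, h2]))
    (hasDerivAt_coeff_mul (hD (n + 1)) (hD m))
  have hzero := hder.unique ((hasDerivAt_const (0 : ℝ) (0 : ℝ)).congr_of_eventuallyEq
    (horth (n + 1) m hm.ne'))
  have hlow : hv.functional (Q (n + 1) 0 * D m) = 0 :=
    orthogonal_of_degree_lt hmonic0 hdeg0 horth0
      ((hDdeg m).trans (by exact_mod_cast hm))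
  rw [← HasExpMoments.functional_apply, map_sub, map_add, hlow, add_zero, sub_eq_zero] at hzero
  rw [hzero, mul_assoc (2 * X)]

/-- The Gaussian weight with Fisher–Hartwig type zeros of order `γ k` at the points `x k`. -/
noncomputable def gaussZeroWeight {N : ℕ} (γ x : Fin N → ℝ) (y : ℝ) : ℝ :=
  Real.exp (-y ^ 2) * ∏ k, |y - x k| ^ γ k

section GaussZeroWeight

variable {N : ℕ} {γ : Fin N → ℝ}

theorem gaussZeroWeight_nonneg (x : Fin N → ℝ) (y : ℝ) : 0 ≤ gaussZeroWeight γ x y :=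
  mul_nonneg (Real.exp_nonneg _) (Finset.prod_nonneg fun _ _ => by positivity)

theorem gaussZeroWeight_add (x : Fin N → ℝ) (s z : ℝ) :
    gaussZeroWeight γ (fun k => x k + s) (z + s) =
      Real.exp (-s ^ 2) * (Real.exp (-2 * s * z) * gaussZeroWeight γ x z) := by
  simp only [gaussZeroWeight, add_sub_add_right_eq_sub, ← mul_assoc, ← Real.exp_add]
  congr 2; ring

theorem integral_eval_mul_gaussZeroWeight_add (x : Fin N → ℝ) (s : ℝ) (p : ℝ[X]) :
    ∫ y, p.eval y * gaussZeroWeight γ (fun k => x k + s) y = Real.exp (-s ^ 2) *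
      ∫ z, (taylor s p).eval z * (Real.exp (-2 * s * z) * gaussZeroWeight γ x z) := by
  rw [← integral_add_right_eq_self _ s, ← integral_const_mul]
  refine integral_congr_ae (Filter.Eventually.of_forall fun z => ?_)
  simp only [gaussZeroWeight_add, taylor_eval]
  ring

theorem integral_eval_mul_gaussZeroWeight_div_add (x : Fin N → ℝ) (j : Fin N) (s : ℝ)
    (p : ℝ[X]) :
    ∫ y, p.eval y * (gaussZeroWeight γ (fun k => x k + s) y / (y - (x j + s))) =
      Real.exp (-s ^ 2) * ∫ z, (taylor s p).eval z *
        (Real.exp (-2 * s * z) * (gaussZeroWeight γ x z / (z - x j))) := by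
  rw [← integral_add_right_eq_self _ s, ← integral_const_mul]
  refine integral_congr_ae (Filter.Eventually.of_forall fun z => ?_)
  simp only [gaussZeroWeight_add, taylor_eval, add_sub_add_right_eq_sub]
  ring

theorem integral_X_sub_C_mul_gaussZeroWeight_div (x : Fin N → ℝ) (j : Fin N) (p : ℝ[X]) :
    ∫ z, ((X - C (x j)) * p).eval z * (gaussZeroWeight γ x z / (z - x j)) =
      ∫ z, p.eval z * gaussZeroWeight γ x z := by
  refine integral_congr_ae ?_
  filter_upwards [Measure.ae_ne volume (x j)] with z hz
  have : z - x j ≠ 0 := sub_ne_zero.2 hz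
  simp only [eval_mul, eval_sub, eval_X, eval_C]
  field_simp

variable (hγ : ∀ k, 0 < γ k)
include hγ

theorem continuous_gaussZeroWeight (x : Fin N → ℝ) : Continuous (gaussZeroWeight γ x) := by
  unfold gaussZeroWeight
  refine (by fun_prop : Continuous fun y : ℝ => Real.exp (-y ^ 2)).mul
    (continuous_finsetProd _ fun k _ => ?_)
  exact (by fun_prop : Continuous fun y : ℝ => |y - x k|).rpow_const fun _ => Or.inr (hγ k).le

theorem exists_exp_mul_gaussZeroWeight_le (x : Fin N → ℝ) (c : ℝ) :
    ∃ K, ∀ y, Real.exp (c * |y|) * gaussZeroWeight γ x y ≤ K * Real.exp (-(1 / 2) * y ^ 2) := by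
  set b := c + ∑ k, γ k with hb
  refine ⟨Real.exp (∑ k, γ k * |x k| + b ^ 2 / 2), fun y => ?_⟩
  have hprod : ∏ k, |y - x k| ^ γ k ≤ Real.exp (∑ k, γ k * |x k| + (∑ k, γ k) * |y|) := by
    rw [Finset.sum_mul, ← Finset.sum_add_distrib, Real.exp_sum]
    refine Finset.prod_le_prod (fun _ _ => by positivity) fun k _ => ?_
    calc |y - x k| ^ γ k ≤ (Real.exp |y - x k|) ^ γ k := by
          refine Real.rpow_le_rpow (abs_nonneg _) ?_ (hγ k).le
          linarith [Real.add_one_le_exp |y - x k|]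
      _ = Real.exp (|y - x k| * γ k) := by rw [← Real.exp_mul]
      _ ≤ _ := by
          rw [Real.exp_le_exp]
          nlinarith [abs_sub y (x k), hγ k]
  calc Real.exp (c * |y|) * gaussZeroWeight γ x y
      ≤ Real.exp (c * |y|) * (Real.exp (-y ^ 2) *
        Real.exp (∑ k, γ k * |x k| + (∑ k, γ k) * |y|)) := by
        unfold gaussZeroWeight; gcongr
    _ ≤ _ := by
        simp only [← Real.exp_add, Real.exp_le_exp]
        have : c * |y| + (∑ k, γ k) * |y| = b * |y| := by rw [hb]; ring
        nlinarith [sq_nonneg (b - |y|), sq_abs y]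

theorem hasExpMoments_gaussZeroWeight (x : Fin N → ℝ) :
    HasExpMoments (gaussZeroWeight γ x) := fun c => by
  obtain ⟨K, hK⟩ := exists_exp_mul_gaussZeroWeight_le hγ x c
  have hcont := continuous_gaussZeroWeight hγ x
  refine ((integrable_exp_neg_mul_sq (b := 1 / 2) (by norm_num)).const_mul K).mono'
    (by fun_prop : Continuous _).aestronglyMeasurable (Filter.Eventually.of_forall fun y => ?_)
  rw [Real.norm_of_nonneg (mul_nonneg (Real.exp_nonneg _) (gaussZeroWeight_nonneg x y))]
  exact hK y

omit hγ in
theorem integrableOn_abs_sub_rpow {r : ℝ} (hr : -1 < r) (a : ℝ) :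
    IntegrableOn (fun y => |y - a| ^ r) (Set.Icc (a - 1) (a + 1)) := by
  have h1 : IntervalIntegrable (fun y : ℝ => |y| ^ r) volume 0 1 :=
    (intervalIntegral.intervalIntegrable_rpow' hr).congr fun y hy => by
      rw [Set.uIoc_of_le zero_le_one] at hy
      simp only [abs_of_pos hy.1]
  have h2 : IntervalIntegrable (fun y : ℝ => |y| ^ r) volume (-1) 0 := by
    simpa using ((IntervalIntegrable.iff_comp_neg (by simp)).1 h1).symm
  have h3 := (h2.trans h1).comp_sub_right a
  rw [intervalIntegrable_iff_integrableOn_Icc_of_le (by linarith)] at h3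
  rwa [show (-1 : ℝ) + a = a - 1 by ring, show (1 : ℝ) + a = a + 1 by ring] at h3

theorem hasExpMoments_gaussZeroWeight_div (x : Fin N → ℝ) (j : Fin N) :
    HasExpMoments fun y => gaussZeroWeight γ x y / (y - x j) := fun c => by
  have hcont := continuous_gaussZeroWeight hγ x
  set rest : ℝ → ℝ := fun y => Real.exp (c * |y|) *
    (Real.exp (-y ^ 2) * ∏ k ∈ Finset.univ.erase j, |y - x k| ^ γ k) with hrest
  have hrestc : Continuous rest := by
    refine (by fun_prop : Continuous fun y : ℝ => Real.exp (c * |y|)).mul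
      ((by fun_prop : Continuous fun y : ℝ => Real.exp (-y ^ 2)).mul
      (continuous_finsetProd _ fun k _ => ?_))
    exact (by fun_prop : Continuous fun y : ℝ => |y - x k|).rpow_const fun _ => Or.inr (hγ k).le
  obtain ⟨K, hK⟩ := (isCompact_Icc (a := x j - 1) (b := x j + 1)).exists_bound_of_continuousOn
    hrestc.continuousOn
  have hint := IntegrableOn.integrable_indicator ((integrableOn_abs_sub_rpow (r := γ j - 1)
    (by linarith [hγ j]) (x j)).const_mul K) measurableSet_Icc
  refine ((hasExpMoments_gaussZeroWeight hγ x c).add hint).mono' ?_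
    (Filter.Eventually.of_forall fun y => ?_)
  · exact ((by fun_prop : Continuous fun y : ℝ => Real.exp (c * |y|)).measurable.mul
      (hcont.measurable.div (by fun_prop))).aestronglyMeasurable
  · have hw := mul_nonneg (Real.exp_nonneg (c * |y|)) (gaussZeroWeight_nonneg (γ := γ) x y)
    rw [norm_mul, norm_div, Real.norm_of_nonneg (Real.exp_nonneg _),
      Real.norm_of_nonneg (gaussZeroWeight_nonneg x y), Real.norm_eq_abs, ← mul_div_assoc,
      Pi.add_apply]
    by_cases hy : y ∈ Set.Icc (x j - 1) (x j + 1)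
    · rw [Set.indicator_of_mem hy]
      rcases eq_or_ne y (x j) with rfl | hne
      · have := (norm_nonneg _).trans (hK _ hy)
        simp only [sub_self, abs_zero, div_zero]
        positivity
      · have hpos : 0 < |y - x j| := abs_pos.2 (sub_ne_zero.2 hne)
        have hsplit : Real.exp (c * |y|) * gaussZeroWeight γ x y / |y - x j| =
            rest y * |y - x j| ^ (γ j - 1) := by
          rw [Real.rpow_sub_one hpos.ne', gaussZeroWeight, hrest,
            ← Finset.mul_prod_erase _ _ (Finset.mem_univ j)]
          ring
        rw [hsplit]
        have : rest y * |y - x j| ^ (γ j - 1) ≤ K * |y - x j| ^ (γ j - 1) := by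
          gcongr; exact (le_abs_self _).trans (hK y hy)
        linarith
    · rw [Set.indicator_of_notMem hy, add_zero]
      refine div_le_self hw ?_
      rw [Set.mem_Icc, not_and_or, not_le, not_le] at hy
      rw [le_abs]
      rcases hy with hy | hy
      · right; linarith
      · left; linarith

omit hγ in
theorem hasDerivAt_gaussZeroWeight (x : Fin N → ℝ) {y : ℝ} (hy : ∀ k, y ≠ x k) :
    HasDerivAt (gaussZeroWeight γ x) (-2 * y * gaussZeroWeight γ x y +
      ∑ k, γ k * (gaussZeroWeight γ x y / (y - x k))) y := by
  have hexp : HasDerivAt (fun y : ℝ => Real.exp (-y ^ 2)) (Real.exp (-y ^ 2) * (-(2 * y))) y := by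
    simpa using ((hasDerivAt_pow 2 y).neg).exp
  have habs : ∀ k ∈ Finset.univ, HasDerivAt (fun y => |y - x k| ^ γ k)
      (γ k * (|y - x k| ^ γ k / (y - x k))) y := fun k _ => by
    have hne : y - x k ≠ 0 := sub_ne_zero.2 (hy k)
    have h1 : HasDerivAt (fun y => |y - x k|) (SignType.sign (y - x k) : ℝ) y := by
      simpa [Function.comp_def] using (hasDerivAt_abs hne).comp y ((hasDerivAt_id y).sub_const (x k))
    refine (h1.rpow_const (p := γ k) (Or.inl (abs_ne_zero.2 hne))).congr_deriv ?_
    rw [Real.rpow_sub_one (abs_ne_zero.2 hne), ← mul_div_assoc, ← mul_div_assoc,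
      div_eq_div_iff (abs_ne_zero.2 hne) hne]
    have hsq : (SignType.sign (y - x k) : ℝ) * SignType.sign (y - x k) = 1 := by
      rcases lt_or_gt_of_ne hne with hs | hs
      · simp [sign_neg hs]
      · simp [sign_pos hs]
    linear_combination (γ k * |y - x k| ^ γ k * |y - x k|) * hsq -
      (SignType.sign (y - x k) * γ k * |y - x k| ^ γ k) * sign_mul_abs (y - x k)
  refine (hexp.mul (HasDerivAt.fun_finsetProd habs)).congr_deriv ?_
  simp only [gaussZeroWeight, Finset.mul_sum, smul_eq_mul]
  congr 1
  · ring
  · refine Finset.sum_congr rfl fun k hk => ?_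
    rw [← Finset.mul_prod_erase _ _ hk]; ring

theorem tendsto_eval_mul_gaussZeroWeight (x : Fin N → ℝ) (p : ℝ[X]) :
    Filter.Tendsto (fun y => p.eval y * gaussZeroWeight γ x y) (Filter.cocompact ℝ) (nhds 0) := by
  obtain ⟨K, hK⟩ := exists_exp_mul_gaussZeroWeight_le hγ x 0
  have hmon : ∀ m : ℕ, Filter.Tendsto (fun y => y ^ m * gaussZeroWeight γ x y)
      (Filter.cocompact ℝ) (nhds 0) := fun m => by
    refine squeeze_zero_norm (fun y => ?_) (by simpa using
      (tendsto_rpow_abs_mul_exp_neg_mul_sq_cocompact (a := 1 / 2) (by norm_num) m).const_mul K)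
    have h1 := hK y
    rw [zero_mul, Real.exp_zero, one_mul] at h1
    rw [norm_mul, Real.norm_of_nonneg (gaussZeroWeight_nonneg x y), norm_pow, Real.norm_eq_abs]
    calc |y| ^ m * gaussZeroWeight γ x y
        ≤ |y| ^ m * (K * Real.exp (-(1 / 2) * y ^ 2)) := by gcongr
      _ = _ := by norm_num; ring
  simp only [eval_eq_sum_range, Finset.sum_mul, mul_assoc]
  simpa using tendsto_finsetSum (Finset.range (p.natDegree + 1)) fun i _ =>
    (hmon i).const_mul (p.coeff i)

/-- Integration by parts against the weight. -/
theorem integral_derivative_mul_gaussZeroWeight (x : Fin N → ℝ) (p : ℝ[X]) :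
    (∫ y, (derivative p - 2 * X * p).eval y * gaussZeroWeight γ x y) +
      ∑ k, γ k * ∫ y, p.eval y * (gaussZeroWeight γ x y / (y - x k)) = 0 := by
  have hw := hasExpMoments_gaussZeroWeight hγ x
  have hwk := hasExpMoments_gaussZeroWeight_div hγ x
  have hcont := continuous_gaussZeroWeight hγ x
  have hi1 := hw.integrable_eval_mul (derivative p - 2 * X * p)
  have hi2 : ∀ k ∈ Finset.univ, Integrable fun y =>
      γ k * (p.eval y * (gaussZeroWeight γ x y / (y - x k))) := fun k _ =>
    ((hwk k).integrable_eval_mul p).const_mul (γ k)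
  have hi := hi1.add (integrable_finsetSum _ hi2)
  simp only [← integral_const_mul]
  rw [← integral_finsetSum _ hi2, ← integral_add hi1 (integrable_finsetSum _ hi2)]
  refine tendsto_nhds_unique (intervalIntegral_tendsto_integral hi
    Filter.tendsto_neg_atTop_atBot Filter.tendsto_id) ?_
  have hftc : ∀ T : ℝ, ∫ y in (-T)..T, ((derivative p - 2 * X * p).eval y * gaussZeroWeight γ x y +
      ∑ k, γ k * (p.eval y * (gaussZeroWeight γ x y / (y - x k)))) =
      p.eval T * gaussZeroWeight γ x T - p.eval (-T) * gaussZeroWeight γ x (-T) := fun T => by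
    refine integral_eq_of_hasDerivAt_off_countable (fun y => p.eval y * gaussZeroWeight γ x y) _
      (s := Set.range x) (Set.finite_range x).countable
      (by fun_prop : Continuous _).continuousOn ?_ hi.intervalIntegrable
    rintro y ⟨-, hy⟩
    refine ((p.hasDerivAt y).mul (hasDerivAt_gaussZeroWeight x fun k hk =>
      hy ⟨k, hk.symm⟩)).congr_deriv ?_
    simp only [eval_sub, eval_mul, eval_X, eval_ofNat, mul_add, Finset.mul_sum]
    rw [← add_assoc]
    congr 1
    · ring
    · exact Finset.sum_congr rfl fun k _ => by ring
  simp only [hftc, id]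
  have hlim := tendsto_eval_mul_gaussZeroWeight hγ x p
  simpa using (hlim.mono_left atTop_le_cocompact).sub
    ((hlim.mono_left atBot_le_cocompact).comp Filter.tendsto_neg_atTop_atBot)

end GaussZeroWeight

/-- The diagonal derivative as the sum of the partial derivatives. -/
theorem hasDerivAt_diagonal {N : ℕ} {f : (Fin N → ℝ) → ℝ} {x : Fin N → ℝ}
    (hf : DifferentiableAt ℝ f x) :
    HasDerivAt (fun s : ℝ => f fun k => x k + s) (∑ k, pd k f x) 0 := by
  have hpd : ∀ k, pd k f x = fderiv ℝ f x (Pi.single k 1) := fun k => by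
    have hf' : HasFDerivAt f (fderiv ℝ f x) (Function.update x k (x k)) := by
      rw [Function.update_eq_self]; exact hf.hasFDerivAt
    exact (hf'.comp_hasDerivAt (x k) (hasDerivAt_update x k (x k))).deriv
  have hline : HasDerivAt (fun (s : ℝ) (k : Fin N) => x k + s) (∑ k, Pi.single k (1 : ℝ)) 0 := by
    rw [hasDerivAt_pi]
    intro k
    rw [Finset.sum_apply]
    simpa [Pi.single_apply] using (hasDerivAt_id (0 : ℝ)).const_add (x k)
  have hf' : HasFDerivAt f (fderiv ℝ f x) (fun k => x k + 0) := by
    simpa using hf.hasFDerivAt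
  simpa [hpd, Function.comp_def] using hf'.comp_hasDerivAt (0 : ℝ) hline

theorem riccati_R
    (N : ℕ) (hN : 1 ≤ N) (γ : Fin N → ℝ) (hγ : ∀ j, 0 < γ j)
    (U : Set (Fin N → ℝ)) (hU : IsOpen U) (hUinj : ∀ x ∈ U, Function.Injective x)
    (w : (Fin N → ℝ) → ℝ → ℝ)
    (hw : ∀ x ∈ U, ∀ y : ℝ, w x y = Real.exp (-y ^ 2) * ∏ j, |y - x j| ^ γ j)
    (P : ℕ → (Fin N → ℝ) → Polynomial ℝ)
    (hPmonic : ∀ n, ∀ x ∈ U, (P n x).Monic) (hPdeg : ∀ n, ∀ x ∈ U, (P n x).natDegree = n)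
    (horth : ∀ m n, m ≠ n → ∀ x ∈ U, ∫ y : ℝ, (P m x).eval y * (P n x).eval y * w x y = 0)
    (h : ℕ → (Fin N → ℝ) → ℝ)
    (hh : ∀ n, ∀ x ∈ U, h n x = ∫ y : ℝ, ((P n x).eval y) ^ 2 * w x y)
    (hhpos : ∀ n, ∀ x ∈ U, 0 < h n x)
    (β : ℕ → (Fin N → ℝ) → ℝ) (hβ0 : ∀ x ∈ U, β 0 x = 0)
    (hβ : ∀ n, ∀ x ∈ U, β (n + 1) x = h (n + 1) x / h n x)
    (α : ℕ → (Fin N → ℝ) → ℝ)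
    (hα : ∀ n, ∀ x ∈ U, α n x = (∫ y : ℝ, y * ((P n x).eval y) ^ 2 * w x y) / h n x)
    (p : ℕ → (Fin N → ℝ) → ℝ) (hp0 : ∀ x ∈ U, p 0 x = 0)
    (hp : ∀ n, ∀ x ∈ U, p (n + 1) x = (P (n + 1) x).coeff n)
    (R : ℕ → Fin N → (Fin N → ℝ) → ℝ)
    (hR : ∀ n j, ∀ x ∈ U, R n j x = γ j / h n x * ∫ y : ℝ, ((P n x).eval y) ^ 2 * w x y / (y - x j))
    (r : ℕ → Fin N → (Fin N → ℝ) → ℝ) (hr0 : ∀ j, ∀ x ∈ U, r 0 j x = 0)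
    (hr : ∀ n j, ∀ x ∈ U, r (n + 1) j x = γ j / h n x * ∫ y : ℝ, (P (n + 1) x).eval y * (P n x).eval y * w x y / (y - x j))
    (hPC2 : ∀ m k, ContDiffOn ℝ 2 (fun x => (P m x).coeff k) U)
    (hhC2 : ∀ m, ContDiffOn ℝ 2 (h m) U)
    (hαC2 : ∀ m, ContDiffOn ℝ 2 (α m) U)
    (hβC2 : ∀ m, ContDiffOn ℝ 2 (β m) U)
    (hpC2 : ∀ m, ContDiffOn ℝ 2 (p m) U)
    (hRC2 : ∀ m j, ContDiffOn ℝ 2 (R m j) U)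
    (hrC2 : ∀ m j, ContDiffOn ℝ 2 (r m j) U)
    (n : ℕ) (j : Fin N) (x : Fin N → ℝ) (hx : x ∈ U) :
    (∑ k, pd k (R n j) x) = 4 * r n j x - (2 * x j - ∑ k, R n k x) * R n j x - 2 * γ j := by
  have hline : Continuous fun (s : ℝ) (k : Fin N) => x k + s := by fun_prop
  have hx0 : (fun k => x k + (0 : ℝ)) = x := by simp
  have hmem : ∀ᶠ s : ℝ in nhds 0, (fun k => x k + s) ∈ U :=
    hline.continuousAt.eventually_mem (by simpa only [hx0] using hU.mem_nhds hx)
  have hdiag : ∀ {f : (Fin N → ℝ) → ℝ}, ContDiffOn ℝ 2 f U →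
      HasDerivAt (fun s : ℝ => f fun k => x k + s) (∑ k, pd k f x) 0 := fun hf =>
    hasDerivAt_diagonal ((hf.contDiffAt (hU.mem_nhds hx)).differentiableAt (by norm_num))
  have hweq : ∀ y ∈ U, w y = gaussZeroWeight γ y := fun y hy => funext (hw y hy)
  have hv := hasExpMoments_gaussZeroWeight hγ x
  have hvj := hasExpMoments_gaussZeroWeight_div hγ x
  set Q : ℕ → ℝ → ℝ[X] := fun m s => taylor s (P m fun k => x k + s) with hQ
  have hQ0 : ∀ m, Q m 0 = P m x := fun m => by simp [hQ]
  have hQdeg : ∀ m, ∀ᶠ s in nhds 0, (Q m s).natDegree = m := fun m => by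
    filter_upwards [hmem] with s hs
    rw [hQ, natDegree_taylor, hPdeg m _ hs]
  have hsq : ∀ m y, y ∈ U → h m y = ∫ z, (P m y * P m y).eval z * gaussZeroWeight γ y z :=
    fun m y hy => by simp only [hh m y hy, hweq y hy, eval_mul, sq]
  have hRint : ∀ k y, y ∈ U → R n k y = γ k / h n y *
      ∫ z, (P n y * P n y).eval z * (gaussZeroWeight γ y z / (z - y k)) := fun k y hy => by
    simp only [hR n k y hy, hweq y hy, eval_mul, sq, mul_div_assoc]
  have hnorm : ∀ m, hv.functional (Q m 0 * Q m 0) = h m x := fun m => by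
    rw [hQ0, hsq m x hx, HasExpMoments.functional_apply]
  obtain ⟨D, hD, hD0, hDsucc⟩ := hv.exists_hasDerivAt_orthogonal (Q := Q)
    (fun m => by
      filter_upwards [hmem] with s hs
      rw [Monic, hQ, leadingCoeff_taylor, hPmonic m _ hs])
    hQdeg
    (fun m => differentiableAt_coeff_taylor
      (by filter_upwards [hmem] with s hs using hPdeg m _ hs)
      fun k => (hdiag (hPC2 m k)).differentiableAt)
    (fun m l hml => by
      filter_upwards [hmem] with s hs
      have h1 := horth m l hml _ hs
      simp only [hweq _ hs, ← eval_mul, integral_eval_mul_gaussZeroWeight_add, taylor_mul] at h1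
      exact (mul_eq_zero.1 h1).resolve_left (Real.exp_ne_zero _))
    (fun m => by rw [hnorm]; exact (hhpos m x hx).ne')
  have hQQdeg : ∀ᶠ s in nhds 0, (Q n s * Q n s).natDegree ≤ n + n := by
    filter_upwards [hQdeg n] with s hs
    exact natDegree_mul_le.trans (by rw [hs])
  have hQQ := hasDerivAt_coeff_mul (hD n) (hD n)
  have hH := hv.hasDerivAt_integral_eval hQQdeg hQQ
  have hJ := (hvj j).hasDerivAt_integral_eval hQQdeg hQQ
  have hhx := hhpos n x hx
  have horthx : ∀ m l, m ≠ l → hv.functional (P m x * P l x) = 0 := fun m l hml => by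
    simpa only [HasExpMoments.functional_apply, eval_mul, hweq x hx] using horth m l hml x hx
  have hDQ : hv.functional (D n * P n x) = 0 := by
    cases n with
    | zero => simp [hD0]
    | succ n =>
      rw [hDsucc, hQ0 n, mul_assoc, ← smul_eq_C_mul, map_smul, horthx n (n + 1) (by omega),
        smul_zero]
  have hDQj : γ j * (hvj j).functional (D n * P n x) = 2 * h n x * r n j x := by
    cases n with
    | zero => simp [hD0, hr0 j x hx]
    | succ n =>
      have := (hhpos n x hx).ne'
      rw [hDsucc, hnorm, hnorm, hQ0 n, mul_assoc, ← smul_eq_C_mul, map_smul, hr n j x hx,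
        HasExpMoments.functional_apply, mul_comm (P n x)]
      simp only [hweq x hx, eval_mul, smul_eq_mul, mul_div_assoc]
      field_simp
  have hderiv : hv.functional (derivative (P n x * P n x)) = 0 := by
    have hlt : (derivative (P n x)).degree < n := by
      simpa only [degree_eq_natDegree (hPmonic n x hx).ne_zero, hPdeg n x hx] using
        degree_derivative_lt (hPmonic n x hx).ne_zero
    have h1 := orthogonal_of_degree_lt (fun m => hPmonic m x hx) (fun m => hPdeg m x hx) horthx hlt
    rw [derivative_mul, mul_comm (derivative _), map_add, h1, add_zero]
  have hIBP := integral_derivative_mul_gaussZeroWeight hγ x (P n x * P n x)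
  rw [← hv.functional_apply, map_sub, hderiv, zero_sub] at hIBP
  have hsum : h n x * ∑ k, R n k x = hv.functional (2 * X * (P n x * P n x)) := by
    rw [Finset.mul_sum, neg_add_eq_zero.1 hIBP]
    refine Finset.sum_congr rfl fun k _ => ?_
    rw [hRint k x hx]
    field_simp
  have hXj : (hvj j).functional (2 * X * (P n x * P n x)) =
      2 * (h n x + x j * (hvj j).functional (P n x * P n x)) := by
    have h1 := integral_X_sub_C_mul_gaussZeroWeight_div (γ := γ) x j (P n x * P n x)
    rw [← (hvj j).functional_apply, ← hsq n x hx, sub_mul, map_sub, ← smul_eq_C_mul, map_smul,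
      smul_eq_mul, sub_eq_iff_eq_add] at h1
    rw [← h1, mul_assoc, two_mul, map_add, two_mul]
  have hRx := hRint j x hx
  rw [← (hvj j).functional_apply] at hRx
  have hReq : (fun s : ℝ => R n j fun k => x k + s) =ᶠ[nhds 0] fun s => γ j *
      ((∫ z, (Q n s * Q n s).eval z *
        (Real.exp (-2 * s * z) * (gaussZeroWeight γ x z / (z - x j)))) /
      ∫ z, (Q n s * Q n s).eval z * (Real.exp (-2 * s * z) * gaussZeroWeight γ x z)) := by
    filter_upwards [hmem] with s hs
    have hne := (hhpos n _ hs).ne'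
    rw [hRint j _ hs, integral_eval_mul_gaussZeroWeight_div_add]
    rw [hsq n _ hs, integral_eval_mul_gaussZeroWeight_add] at hne ⊢
    simp only [taylor_mul, hQ] at hne ⊢
    have := right_ne_zero_of_mul hne
    field_simp
  have hH0 : (∫ z, (Q n 0 * Q n 0).eval z *
      (Real.exp (-2 * 0 * z) * gaussZeroWeight γ x z)) = h n x := by
    rw [hQ0, hsq n x hx]; simp
  have hJ0 : (∫ z, (Q n 0 * Q n 0).eval z *
      (Real.exp (-2 * 0 * z) * (gaussZeroWeight γ x z / (z - x j)))) =
      (hvj j).functional (P n x * P n x) := by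
    rw [hQ0, (hvj j).functional_apply]; simp
  have hquot := ((hJ.div hH (by rw [hH0]; exact hhx.ne')).const_mul (γ j))
  rw [(hdiag (hRC2 n j)).unique (hquot.congr_of_eventuallyEq hReq), hH0, hJ0,
    ← hv.functional_apply, ← (hvj j).functional_apply, hQ0, mul_comm (P n x) (D n)]
  simp only [map_sub, map_add, hDQ, hXj, ← hsum]
  rw [hRx]
  generalize ∑ k, R n k x = S
  generalize (hvj j).functional (P n x * P n x) = J
  generalize (hvj j).functional (D n * P n x) = T at hDQj ⊢
  field_simp
  linear_combination (2 * h n x) * hDQj
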